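/- Let (R, m) be a local regular domain of dimension n > 1 containing an algebraically closed field k with k ≅ R/m, and let (T, n) be a quadratic transformation of R. Then the following are equivalent: (1) dim T = n; (2) tr.deg_{R/m}(T/n) = 0; (3) the natural homomorphism k → T/n is an isomorphism; (4) for every regular system of parameters x₁,...,xₙ of R there exist j and constants a_i ∈ k (i ≠ j) such that x₁/x_j − a₁, ..., x_{j−1}/x_j − a_{j−1}, x_j, x_{j+1}/x_j − a_{j+1}, ..., xₙ/x_j − aₙ form a regular system of parameters of T. -/

import Mathlib

set_option synthInstance.maxHeartbeats 1000000
set_option maxHeartbeats 2000000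

open IsLocalRing

noncomputable section

/-- The ideal generated by the nonunits of a ring (the maximal ideal, if the ring is local). -/
def nuIdeal (A : Type*) [CommRing A] : Ideal A := Ideal.span {a : A | ¬ IsUnit a}

/-- A commutative ring is regular local if it is a Noetherian local ring whose maximal ideal
can be generated by `dim` elements. -/
def IsRegLoc (A : Type*) [CommRing A] : Prop :=
  IsLocalRing A ∧ IsNoetherianRing A ∧
    ∃ s : Finset A, (Ideal.span (s : Set A) = nuIdeal A) ∧
      ((s.card : ℕ) : WithBot (WithTop ℕ)) = ringKrullDim A

variable (R : Type*) [CommRing R] [IsDomain R]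

/-- The ring `A[m_A/x]` inside the fraction field (where `m_A` is the ideal generated by
the nonunits of `A`, i.e. the maximal ideal when `A` is local). -/
def S1 (A : Subalgebra R (FractionRing R)) (x : A) : Subalgebra R (FractionRing R) :=
  Algebra.adjoin R ((A : Set (FractionRing R)) ∪
    {z | ∃ a : A, a ∈ nuIdeal A ∧ z = (a : FractionRing R) / (x : FractionRing R)})

/-- The localization of a subalgebra `S` of the fraction field at a prime `p`, realized as a
subalgebra of the fraction field: `S[(S \ p)⁻¹]`. -/
def locSub (S : Subalgebra R (FractionRing R)) (p : Ideal S) : Subalgebra R (FractionRing R) :=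
  Algebra.adjoin R ((S : Set (FractionRing R)) ∪
    {z | ∃ s : S, s ∉ p ∧ z = (s : FractionRing R)⁻¹})

/-- `x`, viewed as an element of `A[m_A/x]`. -/
def xIn (A : Subalgebra R (FractionRing R)) (x : A) : S1 R A x :=
  ⟨(x : FractionRing R), Algebra.subset_adjoin (Or.inl x.2)⟩

/-- `B` is a (first) quadratic transform of `A`: there are `x ∈ m_A \ m_A²` and a prime ideal
`p` of `S := A[m_A/x]` containing `x` such that `B = S_p`. -/
def QuadStep (A B : Subalgebra R (FractionRing R)) : Prop :=
  ∃ x : A, x ∈ nuIdeal A ∧ x ∉ (nuIdeal A) ^ 2 ∧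
    ∃ p : Ideal (S1 R A x), p.IsPrime ∧ xIn R A x ∈ p ∧ B = locSub R (S1 R A x) p

theorem exists_ltSeries_of_surjective {A B : Type*} [CommRing A] [CommRing B] (f : A →+* B)
    (hf : Function.Surjective f) (q : LTSeries (PrimeSpectrum A))
    (hq : RingHom.ker f ≤ q.head.asIdeal) :
    ∃ q' : LTSeries (PrimeSpectrum B), q'.length = q.length ∧
      q'.last.asIdeal.comap f = q.last.asIdeal := by
  have hker (i) : RingHom.ker f ≤ (q i).asIdeal :=
    hq.trans (q.monotone (Fin.zero_le i))
  have hcm (i) : ((q i).asIdeal.map f).comap f = (q i).asIdeal := by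
    rw [Ideal.comap_map_of_surjective' f hf, sup_eq_left.mpr (hker i)]
  refine ⟨⟨q.length, fun i ↦ ⟨(q i).asIdeal.map f,
    Ideal.map_isPrime_of_surjective hf (hker i)⟩, fun i ↦ ?_⟩, rfl, hcm _⟩
  have hlt : q i.castSucc < q i.succ := q.step i
  refine lt_of_le_of_ne (Ideal.map_mono hlt.le) fun h ↦ hlt.ne ?_
  have h' := congrArg (Ideal.comap f) h
  simp only [hcm] at h'
  exact PrimeSpectrum.ext h'

theorem MvPolynomial.height_ker_add_le {R F : Type*} [CommRing R] [IsNoetherianRing R] [Field F]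
    (d : ℕ) (f : MvPolynomial (Fin d) R →+* F) (hf : Function.Surjective (f.comp C)) :
    (RingHom.ker (f.comp C)).height + d ≤ (RingHom.ker f).height := by
  induction d with
  | zero =>
    have : RingHom.ker (f.comp C) =
        (RingHom.ker f).comap ((isEmptyRingEquiv R (Fin 0)).symm : R →+* _) := by
      ext a
      simp [RingHom.mem_ker]
    simp only [Nat.cast_zero, add_zero]
    rw [this]
    exact (RingEquiv.height_comap (isEmptyRingEquiv R (Fin 0)).symm _).le
  | succ d ih =>
    let g : Polynomial (MvPolynomial (Fin d) R) →+* F :=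
      f.comp ((finSuccEquiv R d).symm : Polynomial (MvPolynomial (Fin d) R) →+* _)
    have hgC : (g.comp Polynomial.C).comp C = f.comp C := by
      ext a
      have : (finSuccEquiv R d).symm (Polynomial.C (C a)) = C a := by
        rw [AlgEquiv.symm_apply_eq]; simp [finSuccEquiv_apply]
      simp [g, this]
    have hs' : Function.Surjective ((g.comp Polynomial.C).comp C) := hgC ▸ hf
    have hs : Function.Surjective (g.comp Polynomial.C) := fun b ↦ by
      obtain ⟨a, rfl⟩ := hs' b; exact ⟨_, rfl⟩
    have hgs : Function.Surjective g := fun b ↦ by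
      obtain ⟨a, rfl⟩ := hs b; exact ⟨_, rfl⟩
    have h1 := ih (g.comp Polynomial.C) hs'
    have := RingHom.ker_isMaximal_of_surjective g hgs
    have : (RingHom.ker g).LiesOver (RingHom.ker (g.comp Polynomial.C)) := ⟨rfl⟩
    have h2 := Polynomial.height_eq_height_add_one (RingHom.ker (g.comp Polynomial.C))
      (RingHom.ker g)
    have h3 : (RingHom.ker g).height = (RingHom.ker f).height :=
      RingEquiv.height_comap (finSuccEquiv R d).symm.toRingEquiv (RingHom.ker f)
    rw [hgC] at h1
    rw [← h3, h2, Nat.cast_add, Nat.cast_one, ← add_assoc]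
    gcongr

theorem MvPolynomial.exists_pow_mul_sub_C_mem {R σ : Type*} [CommRing R] (x : R) (y : σ → R)
    (f : MvPolynomial σ R) :
    ∃ (N : ℕ) (g : R), C x ^ N * f - C g ∈
      Ideal.span (Set.range fun i ↦ C x * X i - C (y i)) := by
  induction f using MvPolynomial.induction_on with
  | C a => exact ⟨0, a, by simp⟩
  | add f f' hf hf' =>
    obtain ⟨N, g, h⟩ := hf
    obtain ⟨N', g', h'⟩ := hf'
    refine ⟨N + N', x ^ N' * g + x ^ N * g', ?_⟩
    convert add_mem (Ideal.mul_mem_left _ (C x ^ N') h) (Ideal.mul_mem_left _ (C x ^ N) h') using 1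
    simp only [map_add, map_mul, map_pow]
    ring
  | mul_X f i hf =>
    obtain ⟨N, g, h⟩ := hf
    refine ⟨N + 1, g * y i, ?_⟩
    convert add_mem (Ideal.mul_mem_left _ (C x * X i) h) (Ideal.mul_mem_left _ (C g)
      (Ideal.subset_span (Set.mem_range_self i))) using 1
    simp only [map_mul]
    ring

theorem succ_le_height_of_chart {R S : Type*} [CommRing R] [IsNoetherianRing R]
    [IsLocalRing R] [CommRing S] [Algebra R S] (hinj : Function.Injective (algebraMap R S))
    {d : ℕ} (x : R) (y : Fin d → R) (z : Fin d → S)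
    (hz : ∀ i, algebraMap R S (y i) = algebraMap R S x * z i)
    (hm : maximalIdeal R = Ideal.span ({x} ∪ Set.range y))
    (hsurj : Function.Surjective (MvPolynomial.aeval (R := R) z))
    (hd : ((d + 1 : ℕ) : ℕ∞) ≤ (maximalIdeal R).height)
    (p : Ideal S) [hp : p.IsMaximal] (hxp : algebraMap R S x ∈ p)
    (hres : Function.Surjective ((Ideal.Quotient.mk p).comp (algebraMap R S))) :
    ((d + 1 : ℕ) : ℕ∞) ≤ p.height := by
  classical
  let φ : MvPolynomial (Fin d) R →+* S := (MvPolynomial.aeval (R := R) z : _ →ₐ[R] S)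
  let := Ideal.Quotient.field p
  have hφC : φ.comp MvPolynomial.C = algebraMap R S := by ext a; simp [φ]
  let ψ := (Ideal.Quotient.mk p).comp φ
  have hψC : ψ.comp MvPolynomial.C = (Ideal.Quotient.mk p).comp (algebraMap R S) := by
    rw [← hφC]; rfl
  have hψ : RingHom.ker ψ = p.comap φ := by
    rw [← RingHom.comap_ker, Ideal.mk_ker]
  have hht := MvPolynomial.height_ker_add_le d ψ (hψC ▸ hres)
  have hkm : RingHom.ker (ψ.comp MvPolynomial.C) = maximalIdeal R := by
    have := RingHom.ker_isMaximal_of_surjective (ψ.comp MvPolynomial.C) (hψC ▸ hres)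
    exact IsLocalRing.eq_maximalIdeal this
  rw [hkm, hψ] at hht
  set M := p.comap φ with hM
  have : M.IsPrime := Ideal.comap_isPrime _ _
  let s : Set (MvPolynomial (Fin d) R) :=
    Set.range fun i ↦ MvPolynomial.C x * MvPolynomial.X i - MvPolynomial.C (y i)
  have hφs : Ideal.span s ≤ RingHom.ker φ := by
    rw [Ideal.span_le]
    rintro _ ⟨i, rfl⟩
    simp [φ, RingHom.mem_ker, hz]
  have hsM : Ideal.span s ≤ M := hφs.trans (Ideal.comap_mono bot_le)
  have hcard : s.encard ≤ d := by
    have := Set.encard_image_le (fun i ↦ MvPolynomial.C x * MvPolynomial.X i -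
      MvPolynomial.C (y i)) (Set.univ : Set (Fin d))
    rw [Set.image_univ, Set.encard_univ] at this
    simpa using this
  have h1 := Ideal.height_le_height_add_encard_of_subset s (p := M)
    (fun a ha ↦ hsM (Ideal.subset_span ha))
  have h2 : ((d + 1 : ℕ) : ℕ∞) ≤ (M.map (Ideal.Quotient.mk (Ideal.span s))).height := by
    have h3 : ((d + 1 : ℕ) : ℕ∞) + d ≤ (M.map (Ideal.Quotient.mk (Ideal.span s))).height + d :=
      calc _ ≤ (maximalIdeal R).height + d := by gcongr
        _ ≤ M.height := hht
        _ ≤ _ := h1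
        _ ≤ _ := by gcongr
    exact (ENat.add_le_add_iff_right (ENat.natCast_ne_top d)).mp h3
  have : (M.map (Ideal.Quotient.mk (Ideal.span s))).IsPrime :=
    Ideal.map_isPrime_of_surjective Ideal.Quotient.mk_surjective (by rwa [Ideal.mk_ker])
  obtain ⟨l, hl, hlen⟩ :=
    (M.map (Ideal.Quotient.mk (Ideal.span s))).exists_ltSeries_length_eq_height
  rw [← hlen] at h2
  let l' : LTSeries (PrimeSpectrum (MvPolynomial (Fin d) R)) :=
    l.map (PrimeSpectrum.comap (Ideal.Quotient.mk (Ideal.span s))) (by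
      intro P Q hPQ
      refine lt_of_le_of_ne (Ideal.comap_mono hPQ.le) fun h ↦ hPQ.ne ?_
      exact PrimeSpectrum.comap_injective_of_surjective _ Ideal.Quotient.mk_surjective h)
  have hl'len : l'.length = l.length := rfl
  have hl'last : l'.last.asIdeal = M := by
    have : l'.last.asIdeal = l.last.asIdeal.comap (Ideal.Quotient.mk (Ideal.span s)) := rfl
    rw [this, hl, Ideal.comap_map_of_surjective' _ Ideal.Quotient.mk_surjective, Ideal.mk_ker,
      sup_eq_left.mpr hsM]
  have hl'head : Ideal.span s ≤ l'.head.asIdeal := by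
    have : l'.head.asIdeal = l.head.asIdeal.comap (Ideal.Quotient.mk (Ideal.span s)) := rfl
    rw [this]
    intro a ha
    rw [Ideal.mem_comap, Ideal.Quotient.eq_zero_iff_mem.mpr ha]
    exact zero_mem _
  by_cases hx : MvPolynomial.C x ∈ l'.head.asIdeal
  · exfalso
    have hy (i) : MvPolynomial.C (y i) ∈ l'.head.asIdeal := by
      have h3 := hl'head (Ideal.subset_span (Set.mem_range_self i))
      have h4 := Ideal.mul_mem_right (MvPolynomial.X i) _ hx
      simpa using sub_mem h4 h3
    obtain ⟨l'', hl'', -⟩ := exists_ltSeries_of_surjective (MvPolynomial.map (residue R))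
      (MvPolynomial.map_surjective _ residue_surjective) l' (by
        rw [MvPolynomial.ker_map, IsLocalRing.ker_residue, hm, Ideal.map_span, Ideal.span_le]
        rintro _ ⟨a, rfl | ⟨i, rfl⟩, rfl⟩
        exacts [hx, hy i])
    have h3 := Order.LTSeries.length_le_krullDim l''
    have h4 := MvPolynomial.ringKrullDim_of_isNoetherianRing (R := ResidueField R) (ι := Fin d)
    rw [ringKrullDim_eq_zero_of_field, ringKrullDim] at h4
    rw [h4, hl'', hl'len, zero_add, Nat.card_eq_fintype_card, Fintype.card_fin] at h3
    have h3' : l.length ≤ d := by exact_mod_cast h3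
    have h2' : d + 1 ≤ l.length := by exact_mod_cast h2
    omega
  · obtain ⟨l'', hl'', hlast⟩ := exists_ltSeries_of_surjective φ hsurj l' (by
      intro f hf
      obtain ⟨N, g, h⟩ := MvPolynomial.exists_pow_mul_sub_C_mem x y f
      have h3 := hφs h
      have h4 : algebraMap R S g = 0 := by
        rw [RingHom.mem_ker] at h3 hf
        rw [map_sub, map_mul, hf, mul_zero, zero_sub, neg_eq_zero] at h3
        rw [← h3, ← hφC]; rfl
      have h5 : g = 0 := hinj (by simpa using h4)
      have h6 := hl'head h
      rw [h5, map_zero, sub_zero] at h6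
      exact (l'.head.isPrime.mem_or_mem h6).resolve_left
        fun h7 ↦ hx (l'.head.isPrime.mem_of_pow_mem _ h7))
    have h3 : l''.last.asIdeal = p := by
      rw [hl'last, hM] at hlast
      exact Ideal.comap_injective_of_surjective φ hsurj hlast
    rw [← h3, PrimeSpectrum.height_eq_orderHeight]
    refine h2.trans ?_
    rw [← hl'len, ← hl'']
    exact Order.length_le_height le_rfl

/-- The subring of elements of `B` that agree modulo `N` with an element of the image of `ι`. -/
def Ideal.constantsMod {k B : Type*} [Field k] [CommRing B] (ι : k →+* B) (N : Ideal B) :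
    Subring B :=
  ((Ideal.Quotient.mk N).comp ι).range.comap (Ideal.Quotient.mk N)

theorem Ideal.mem_constantsMod {k B : Type*} [Field k] [CommRing B] {ι : k →+* B} {N : Ideal B}
    {b : B} : b ∈ N.constantsMod ι ↔ ∃ c, b - ι c ∈ N := by
  simp only [constantsMod, Subring.mem_comap, RingHom.mem_range, RingHom.comp_apply]
  refine exists_congr fun c ↦ ?_
  rw [eq_comm, Ideal.Quotient.eq]

theorem Ideal.mem_of_mem_constantsMod {k B : Type*} [Field k] [CommRing B] {ι : k →+* B}
    {N q : Ideal B} (hN : N ≤ q) (hq : q ≠ ⊤) {b : B} (hb : b ∈ N.constantsMod ι) (hbq : b ∈ q) :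
    b ∈ N := by
  obtain ⟨c, hc⟩ := mem_constantsMod.mp hb
  have hcq : ι c ∈ q := by simpa using sub_mem hbq (hN hc)
  have hc0 : c = 0 := by
    by_contra h
    exact hq (Ideal.eq_top_of_isUnit_mem _ hcq ((IsUnit.mk0 c h).map ι))
  simpa [hc0] using hc

theorem Ideal.map_mvPolynomial_mem_constantsMod {k R B σ : Type*} [Field k] [CommRing R]
    [CommRing B] {ι : k →+* B} {N : Ideal B} (φ : MvPolynomial σ R →+* B)
    (hC : ∀ r, φ (MvPolynomial.C r) ∈ N.constantsMod ι)
    (hX : ∀ i, φ (MvPolynomial.X i) ∈ N.constantsMod ι) (f : MvPolynomial σ R) :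
    φ f ∈ N.constantsMod ι := by
  induction f using MvPolynomial.induction_on with
  | C a => exact hC a
  | add f g hf hg => exact map_add φ f g ▸ add_mem hf hg
  | mul_X f i hf => exact map_mul φ f _ ▸ mul_mem hf (hX i)

theorem nuIdeal_eq_maximalIdeal (A : Type*) [CommRing A] [IsLocalRing A] :
    nuIdeal A = maximalIdeal A :=
  le_antisymm (Ideal.span_le.mpr fun _ ha ↦ ha) fun _ ha ↦ Ideal.subset_span ha

theorem exists_span_eq_of_notMem_sq {R : Type*} [CommRing R] [IsLocalRing R] {d : ℕ}
    (y : Fin (d + 1) → R) (hy : Ideal.span (Set.range y) = maximalIdeal R) {x : R}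
    (hx : x ∈ maximalIdeal R) (hx2 : x ∉ maximalIdeal R ^ 2) :
    ∃ y' : Fin d → R, maximalIdeal R = Ideal.span ({x} ∪ Set.range y') := by
  rw [← hy, Ideal.mem_span_range_iff_exists_fun] at hx
  obtain ⟨c, hc⟩ := hx
  have hym (i) : y i ∈ maximalIdeal R := hy ▸ Ideal.subset_span (Set.mem_range_self i)
  obtain ⟨j, hj⟩ : ∃ j, IsUnit (c j) := by
    by_contra! h
    refine hx2 ?_
    rw [← hc, pow_two]
    exact sum_mem fun i _ ↦ Ideal.mul_mem_mul (h i) (hym i)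
  refine ⟨y ∘ j.succAbove, le_antisymm ?_ (Ideal.span_le.mpr ?_)⟩
  · rw [← hy, Ideal.span_le]
    set I := Ideal.span ({x} ∪ Set.range (y ∘ j.succAbove))
    have hI (i) : y (j.succAbove i) ∈ I := Ideal.subset_span (Or.inr ⟨i, rfl⟩)
    rintro _ ⟨i, rfl⟩
    rcases Fin.eq_self_or_eq_succAbove j i with rfl | ⟨i, rfl⟩
    · rw [Fin.sum_univ_succAbove _ i] at hc
      have h1 : c i * y i ∈ I := by
        rw [← sub_eq_of_eq_add hc.symm]
        exact sub_mem (Ideal.subset_span (Or.inl rfl))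
          (sum_mem fun l _ ↦ Ideal.mul_mem_left _ _ (hI l))
      exact (Ideal.unit_mul_mem_iff_mem I hj).mp h1
    · exact hI i
  · rintro _ (rfl | ⟨i, rfl⟩)
    · exact hc ▸ sum_mem fun i _ ↦ Ideal.mul_mem_left _ _ (hym i)
    · exact hym _

theorem aeval_surjective_of_maximalIdeal_le {R : Type*} [CommRing R] [IsDomain R]
    [IsLocalRing R] {x : R} (hx : x ≠ 0)
    {S : Subalgebra R (FractionRing R)}
    (hS : S = Algebra.adjoin R {z : FractionRing R | ∃ a ∈ maximalIdeal R,
      z = algebraMap R (FractionRing R) a / algebraMap R (FractionRing R) x})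
    {σ : Type*} (y : σ → R) (hm : maximalIdeal R ≤ Ideal.span ({x} ∪ Set.range y))
    (z : σ → S) (hz : ∀ i, algebraMap R S (y i) = algebraMap R S x * z i) :
    Function.Surjective (MvPolynomial.aeval (R := R) z) := by
  have hx' : algebraMap R (FractionRing R) x ≠ 0 := by simpa using hx
  have hz' (i) : (z i : FractionRing R) =
      algebraMap R (FractionRing R) (y i) / algebraMap R (FractionRing R) x := by
    rw [eq_div_iff hx', mul_comm]
    exact (congrArg (Subtype.val) (hz i)).symm
  have hle : S ≤ (S.val.comp (MvPolynomial.aeval (R := R) z)).range := by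
    conv_lhs => rw [hS]
    refine Algebra.adjoin_le ?_
    rintro _ ⟨a, ha, rfl⟩
    have ha' := hm ha
    clear ha
    induction ha' using Submodule.span_induction with
    | mem a h =>
      rcases h with rfl | ⟨i, rfl⟩
      · rw [div_self hx']; exact one_mem _
      · exact ⟨MvPolynomial.X i, by simp [hz']⟩
    | zero => rw [map_zero, zero_div]; exact zero_mem _
    | add a b _ _ ha hb => rw [map_add, add_div]; exact add_mem ha hb
    | smul r a _ ha =>
      rw [smul_eq_mul, map_mul, mul_div_assoc, ← Algebra.smul_def]
      exact Subalgebra.smul_mem _ ha r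
  intro s
  obtain ⟨f, hf⟩ := hle s.2
  exact ⟨f, Subtype.ext hf⟩

theorem le_locSub {R : Type*} [CommRing R] [IsDomain R] (S : Subalgebra R (FractionRing R))
    (p : Ideal S) : S ≤ locSub R S p :=
  fun _ hs ↦ Algebra.subset_adjoin (Or.inl hs)

theorem mem_locSub_iff {R : Type*} [CommRing R] [IsDomain R] {S : Subalgebra R (FractionRing R)}
    {p : Ideal S} (hp : p.IsPrime) {t : FractionRing R} :
    t ∈ locSub R S p ↔ ∃ s u : S, u ∉ p ∧ t * u = s := by
  have hne {u : S} (hu : u ∉ p) : (u : FractionRing R) ≠ 0 := fun h ↦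
    hu (by rw [Subtype.ext (a1 := u) (a2 := 0) h]; exact zero_mem _)
  constructor
  · intro ht
    induction ht using Algebra.adjoin_induction with
    | mem t h =>
      rcases h with h | ⟨u, hu, rfl⟩
      · exact ⟨⟨t, h⟩, 1, p.ne_top_iff_one.mp hp.ne_top, by simp⟩
      · exact ⟨1, u, hu, by simpa using inv_mul_cancel₀ (hne hu)⟩
    | algebraMap r => exact ⟨algebraMap R S r, 1, p.ne_top_iff_one.mp hp.ne_top, by simp⟩
    | add a b _ _ ha hb =>
      obtain ⟨s, u, hu, h⟩ := ha
      obtain ⟨s', u', hu', h'⟩ := hb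
      refine ⟨s * u' + s' * u, u * u', fun H ↦ (hp.mem_or_mem H).elim hu hu', ?_⟩
      push_cast
      rw [← h, ← h']; ring
    | mul a b _ _ ha hb =>
      obtain ⟨s, u, hu, h⟩ := ha
      obtain ⟨s', u', hu', h'⟩ := hb
      refine ⟨s * s', u * u', fun H ↦ (hp.mem_or_mem H).elim hu hu', ?_⟩
      push_cast
      rw [← h, ← h']; ring
  · rintro ⟨s, u, hu, h⟩
    rw [(eq_div_iff (hne hu)).mpr h, div_eq_mul_inv]
    exact mul_mem (le_locSub S p s.2) (Algebra.subset_adjoin (Or.inr ⟨u, hu, rfl⟩))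

theorem isLocalization_locSub {R : Type*} [CommRing R] [IsDomain R]
    (S : Subalgebra R (FractionRing R)) (p : Ideal S) [hp : p.IsPrime] :
    letI := (Subalgebra.inclusion (le_locSub S p)).toRingHom.toAlgebra
    IsLocalization.AtPrime (locSub R S p) p := by
  let := (Subalgebra.inclusion (le_locSub S p)).toRingHom.toAlgebra
  have hne {u : S} (hu : u ∉ p) : (u : FractionRing R) ≠ 0 := fun h ↦
    hu (by rw [Subtype.ext (a1 := u) (a2 := 0) h]; exact zero_mem _)
  refine ⟨?_, ?_, ?_⟩
  · rintro ⟨u, hu⟩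
    refine IsUnit.of_mul_eq_one
      ⟨(u : FractionRing R)⁻¹, Algebra.subset_adjoin (Or.inr ⟨u, hu, rfl⟩)⟩ (Subtype.ext ?_)
    exact mul_inv_cancel₀ (hne hu)
  · intro t
    obtain ⟨s, u, hu, h⟩ := (mem_locSub_iff hp).mp t.2
    exact ⟨⟨s, u, hu⟩, Subtype.ext h⟩
  · intro a b h
    have hab : a = b := Subtype.ext (congrArg (fun t : locSub R S p ↦ (t : FractionRing R)) h)
    exact ⟨1, by rw [hab]⟩

theorem Ideal.isMaximal_of_forall_exists_sub_mem {k B : Type*} [Field k] [CommRing B]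
    (ι : k →+* B) {p : Ideal B} (hp : p ≠ ⊤) (h : ∀ b, ∃ c, b - ι c ∈ p) : p.IsMaximal := by
  refine Ideal.isMaximal_iff.mpr ⟨p.ne_top_iff_one.mp hp, fun J b hJ hb hbJ ↦ ?_⟩
  obtain ⟨c, hc⟩ := h b
  have hc0 : c ≠ 0 := by
    rintro rfl
    exact hb (by simpa using hc)
  have hcJ : ι c ∈ J := by simpa using sub_mem hbJ (hJ hc)
  rw [← J.eq_top_iff_one]
  exact Ideal.eq_top_of_isUnit_mem _ hcJ ((IsUnit.mk0 c hc0).map ι)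

theorem height_eq_of_chart {k R S : Type*} [Field k] [CommRing R] [IsNoetherianRing R]
    [IsLocalRing R] [CommRing S] [Algebra k R] [Algebra R S]
    (hinj : Function.Injective (algebraMap R S))
    {d : ℕ} (x : R) (y : Fin d → R) (z : Fin d → S)
    (hz : ∀ i, algebraMap R S (y i) = algebraMap R S x * z i)
    (hm : maximalIdeal R = Ideal.span ({x} ∪ Set.range y))
    (hsurj : Function.Surjective (MvPolynomial.aeval (R := R) z))
    (hd : (maximalIdeal R).height = ((d + 1 : ℕ) : ℕ∞))
    (hk : ∀ r : R, ∃ c : k, r - algebraMap k R c ∈ maximalIdeal R)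
    (p : Ideal S) (hp : p ≠ ⊤) (hxp : algebraMap R S x ∈ p)
    (hres : ∀ s : S, ∃ c : k, s - (algebraMap R S).comp (algebraMap k R) c ∈ p) :
    p.height = ((d + 1 : ℕ) : ℕ∞) := by
  classical
  set ι := (algebraMap R S).comp (algebraMap k R) with hι
  have := Ideal.isMaximal_of_forall_exists_sub_mem ι hp hres
  refine le_antisymm ?_ (succ_le_height_of_chart hinj x y z hz hm hsurj hd.ge p hxp ?_)
  · choose b hb using fun i ↦ hres (z i)
    let g : Option (Fin d) → S := fun o ↦ o.elim (algebraMap R S x) fun i ↦ z i - ι (b i)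
    have hg : Ideal.span (Set.range g) ≤ p := by
      rw [Ideal.span_le]
      rintro _ ⟨_ | i, rfl⟩
      exacts [hxp, hb i]
    have hxg : algebraMap R S x ∈ Ideal.span (Set.range g) := Ideal.subset_span ⟨none, rfl⟩
    have hmg : ∀ r ∈ maximalIdeal R, algebraMap R S r ∈ Ideal.span (Set.range g) := by
      intro r hr
      have : maximalIdeal R ≤ (Ideal.span (Set.range g)).comap (algebraMap R S) := by
        rw [hm, Ideal.span_le]
        rintro _ (rfl | ⟨i, rfl⟩)
        · exact hxg
        · exact Ideal.mem_comap.mpr (hz i ▸ Ideal.mul_mem_right _ _ hxg)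
      exact this hr
    have hpg : p = Ideal.span (Set.range g) := by
      refine le_antisymm (fun s hs ↦ Ideal.mem_of_mem_constantsMod (ι := ι) hg hp ?_ hs) hg
      obtain ⟨f, rfl⟩ := hsurj s
      refine Ideal.map_mvPolynomial_mem_constantsMod (ι := ι)
        (MvPolynomial.aeval (R := R) z : _ →+* S) (fun r ↦ ?_) (fun i ↦ ?_) f
      · obtain ⟨c, hc⟩ := hk r
        exact Ideal.mem_constantsMod.mpr ⟨c, by simpa [hι] using hmg _ hc⟩
      · have hgi : z i - ι (b i) ∈ Ideal.span (Set.range g) := Ideal.subset_span ⟨some i, rfl⟩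
        exact Ideal.mem_constantsMod.mpr ⟨b i, by simpa using hgi⟩
    have : IsNoetherianRing S := isNoetherianRing_of_surjective _ _
      (MvPolynomial.aeval (R := R) z).toRingHom hsurj
    have h1 := Ideal.height_le_card_of_mem_minimalPrimes_span (p := p) (Set.finite_range g) (by
      rw [← hpg, Ideal.minimalPrimes_eq_subsingleton_self]; exact rfl)
    refine h1.trans ?_
    have h2 := Set.ncard_image_le (f := g) (s := Set.univ) Set.finite_univ
    rw [Set.image_univ, Set.ncard_univ, Nat.card_eq_fintype_card, Fintype.card_option,
      Fintype.card_fin] at h2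
    exact_mod_cast h2
  · intro s
    obtain ⟨s, rfl⟩ := Ideal.Quotient.mk_surjective s
    obtain ⟨c, hc⟩ := hres s
    exact ⟨algebraMap k R c, (Ideal.Quotient.eq.mpr hc).symm⟩

/-- A maximal ideal of a finitely generated algebra over an algebraically closed field has trivial
residue field extension; the algebra is only required to be generated over a ring `R` which agrees
with `k` modulo the ideal. -/
theorem Ideal.IsMaximal.exists_sub_mem_of_isAlgClosed {k R S σ : Type*} [Field k] [IsAlgClosed k]
    [Finite σ] [CommRing R] [CommRing S] [Algebra k R] [Algebra R S] (z : σ → S)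
    (hsurj : Function.Surjective (MvPolynomial.aeval (R := R) z)) (q : Ideal S) [q.IsMaximal]
    (hk : ∀ r : R, ∃ c : k, algebraMap R S (r - algebraMap k R c) ∈ q) (s : S) :
    ∃ c : k, s - (algebraMap R S).comp (algebraMap k R) c ∈ q := by
  let := Ideal.Quotient.field q
  set ι := (algebraMap R S).comp (algebraMap k R) with hι
  let : Algebra k (S ⧸ q) := ((Ideal.Quotient.mk q).comp ι).toAlgebra
  have hsur : Function.Surjective
      (MvPolynomial.aeval (R := k) fun i ↦ Ideal.Quotient.mk q (z i)) := by
    intro t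
    obtain ⟨t, rfl⟩ := Ideal.Quotient.mk_surjective t
    obtain ⟨f, rfl⟩ := hsurj t
    induction f using MvPolynomial.induction_on with
    | C a =>
      obtain ⟨c, hc⟩ := hk a
      refine ⟨MvPolynomial.C c, ?_⟩
      rw [MvPolynomial.aeval_C, MvPolynomial.aeval_C, eq_comm]
      exact Ideal.Quotient.eq.mpr (by simpa [hι] using hc)
    | add f g hf hg =>
      obtain ⟨f', hf⟩ := hf
      obtain ⟨g', hg⟩ := hg
      exact ⟨f' + g', by rw [map_add, hf, hg, map_add, map_add]⟩
    | mul_X f i hf =>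
      obtain ⟨f', hf⟩ := hf
      exact ⟨f' * MvPolynomial.X i, by simp [hf]⟩
  have : Algebra.FiniteType k (S ⧸ q) := Algebra.FiniteType.of_surjective _ hsur
  have : Module.Finite k (S ⧸ q) := finite_of_finite_type_of_isJacobsonRing k (S ⧸ q)
  obtain ⟨c, hc⟩ := (IsAlgClosed.algebraMap_bijective_of_isIntegral (k := k)
    (K := S ⧸ q)).2 (Ideal.Quotient.mk q s)
  exact ⟨c, Ideal.Quotient.eq.mp hc.symm⟩

/-- If the coordinate `z j` of a chart becomes invertible in `T`, then the coordinates centred on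
the `j`-th one generate the maximal ideal of `T`. -/
theorem span_chart_eq_maximalIdeal {k R S T σ : Type*} [Field k] [Fintype σ] [DecidableEq σ]
    [CommRing R] [IsLocalRing R] [CommRing S] [CommRing T] [IsLocalRing T] [Algebra k R]
    [Algebra R S] [Algebra R T] (f : S →ₐ[R] T) (x : R) (y : σ → R) (z : σ → S)
    (hz : ∀ i, algebraMap R S (y i) = algebraMap R S x * z i)
    (hm : maximalIdeal R ≤ Ideal.span (Set.range y))
    (hsurj : Function.Surjective (MvPolynomial.aeval (R := R) z))
    (hk : ∀ r : R, ∃ c : k, r - algebraMap k R c ∈ maximalIdeal R)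
    (hxT : algebraMap R T x ∈ maximalIdeal T)
    (r : σ → R) (hr : ∑ i, algebraMap R S (r i) * z i = 1)
    (p : Ideal S) (hp : p.map f = maximalIdeal T)
    (j : σ) (v : T) (hv : f (z j) * v = 1) (a : σ → k)
    (ha : ∀ i, f (z i) * v - (algebraMap R T).comp (algebraMap k R) (a i) ∈ maximalIdeal T) :
    Ideal.span (Set.range fun i ↦ if i = j then algebraMap R T (y j)
      else f (z i) * v - (algebraMap R T).comp (algebraMap k R) (a i)) = maximalIdeal T := by
  set ι := (algebraMap R T).comp (algebraMap k R) with hι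
  set e : σ → T := fun i ↦ if i = j then algebraMap R T (y j) else f (z i) * v - ι (a i) with he
  set N := Ideal.span (Set.range e) with hN
  have heN (i) : e i ∈ N := Ideal.subset_span ⟨i, rfl⟩
  have hyT (i) : algebraMap R T (y i) = algebraMap R T x * f (z i) := by
    simpa using congrArg f (hz i)
  have hle : N ≤ maximalIdeal T := by
    rw [hN, Ideal.span_le]
    rintro _ ⟨i, rfl⟩
    by_cases hij : i = j
    · simpa [he, hij, hyT] using Ideal.mul_mem_right _ _ hxT
    · simpa [he, hij] using ha i
  have hxN : algebraMap R T x ∈ N := by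
    have h := N.mul_mem_right v (heN j)
    simpa [he, hyT, mul_assoc, hv] using h
  have hmN : ∀ r ∈ maximalIdeal R, algebraMap R T r ∈ N := by
    have : maximalIdeal R ≤ N.comap (algebraMap R T) := by
      refine hm.trans (Ideal.span_le.mpr ?_)
      rintro _ ⟨i, rfl⟩
      exact Ideal.mem_comap.mpr (hyT i ▸ Ideal.mul_mem_right _ _ hxN)
    exact this
  have hRC (r : R) : algebraMap R T r ∈ N.constantsMod ι := by
    obtain ⟨c, hc⟩ := hk r
    exact Ideal.mem_constantsMod.mpr ⟨c, by simpa [hι] using hmN _ hc⟩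
  have hwC (i) : f (z i) * v ∈ N.constantsMod ι := by
    by_cases hij : i = j
    · rw [hij, hv]
      exact one_mem _
    · exact Ideal.mem_constantsMod.mpr ⟨a i, by simpa [he, hij] using heN i⟩
  have hvsum : v = ∑ i, algebraMap R T (r i) * (f (z i) * v) := by
    have h := congrArg (f · * v) hr
    simpa [Finset.sum_mul, mul_assoc] using h.symm
  obtain ⟨c, hc⟩ : ∃ c, v - ι c ∈ N := by
    rw [← Ideal.mem_constantsMod, hvsum]
    exact sum_mem fun i _ ↦ mul_mem (hRC _) (hwC i)
  have hvu : v ∉ maximalIdeal T := fun h ↦ h (IsUnit.of_mul_eq_one_right _ hv)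
  have hc0 : c ≠ 0 := by
    rintro rfl
    exact hvu (hle (by simpa using hc))
  have hcc : ι c * ι c⁻¹ = 1 := by rw [← map_mul, mul_inv_cancel₀ hc0, map_one]
  have hzj : f (z j) ∈ N.constantsMod ι := by
    refine Ideal.mem_constantsMod.mpr ⟨c⁻¹, ?_⟩
    have : f (z j) - ι c⁻¹ = -(f (z j) * ι c⁻¹) * (v - ι c) := by
      linear_combination ι c⁻¹ * hv - f (z j) * hcc
    exact this ▸ N.mul_mem_left _ hc
  have hzC (i) : f (z i) ∈ N.constantsMod ι := by
    have : f (z i) = f (z i) * v * f (z j) := by linear_combination -f (z i) * hv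
    exact this ▸ mul_mem (hwC i) hzj
  refine le_antisymm hle ?_
  rw [← hp, Ideal.map_le_iff_le_comap]
  intro s hs
  refine Ideal.mem_of_mem_constantsMod (ι := ι) hle (maximalIdeal.isMaximal T).ne_top ?_
    (hp ▸ Ideal.mem_map_of_mem f hs)
  obtain ⟨P, rfl⟩ := hsurj s
  exact Ideal.map_mvPolynomial_mem_constantsMod (ι := ι)
    ((f : S →+* T).comp (MvPolynomial.aeval (R := R) z : _ →+* S))
    (fun r ↦ by simpa using hRC r) (fun i ↦ by simpa using hzC i) P

/-- A prime ideal of a chart lying over the maximal ideal of `R` has the same height as the maximal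
ideal if and only if its residue field is `k`. -/
theorem height_eq_iff_of_chart {k R S : Type*} [Field k] [IsAlgClosed k] [CommRing R] [IsDomain R]
    [IsNoetherianRing R] [IsLocalRing R] [CommRing S] [IsDomain S] [Algebra k R] [Algebra R S]
    (hinj : Function.Injective (algebraMap R S))
    {d : ℕ} (x : R) (y : Fin d → R) (z : Fin d → S)
    (hz : ∀ i, algebraMap R S (y i) = algebraMap R S x * z i)
    (hm : maximalIdeal R = Ideal.span ({x} ∪ Set.range y))
    (hsurj : Function.Surjective (MvPolynomial.aeval (R := R) z))
    (hd : (maximalIdeal R).height = ((d + 1 : ℕ) : ℕ∞))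
    (hk : ∀ r : R, ∃ c : k, r - algebraMap k R c ∈ maximalIdeal R)
    (p : Ideal S) [p.IsPrime] (hxp : algebraMap R S x ∈ p) :
    p.height = ((d + 1 : ℕ) : ℕ∞) ↔
      ∀ s : S, ∃ c : k, s - (algebraMap R S).comp (algebraMap k R) c ∈ p := by
  refine ⟨fun h ↦ ?_, height_eq_of_chart hinj x y z hz hm hsurj hd hk p
    (Ideal.IsPrime.ne_top ‹_›) hxp⟩
  obtain ⟨q, hq, hpq⟩ := Ideal.exists_le_maximal p (Ideal.IsPrime.ne_top ‹_›)
  have hmq : maximalIdeal R ≤ q.comap (algebraMap R S) := by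
    rw [hm, Ideal.span_le]
    rintro _ (rfl | ⟨i, rfl⟩)
    · exact hpq hxp
    · exact Ideal.mem_comap.mpr (hz i ▸ Ideal.mul_mem_right _ _ (hpq hxp))
  have hresq := Ideal.IsMaximal.exists_sub_mem_of_isAlgClosed z hsurj q fun r ↦
    (hk r).imp fun c hc ↦ hmq hc
  have hqh := height_eq_of_chart hinj x y z hz hm hsurj hd hk q hq.ne_top (hpq hxp) hresq
  rcases hpq.eq_or_lt with rfl | hlt
  · exact hresq
  · have h1 := Ideal.height_add_one_le_of_lt_of_isPrime hlt
    rw [h, hqh] at h1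
    exact absurd (by exact_mod_cast h1 : d + 1 + 1 ≤ d + 1) (by lia)

/-- The residue field of the localization `T` of `S` at `p` is `k` if and only if `S / p` is. -/
theorem bijective_residue_iff_forall_exists_sub_mem {k S T : Type*} [Field k] [CommRing S]
    [CommRing T] [Algebra S T] (p : Ideal S) [p.IsPrime] [IsLocalization.AtPrime T p]
    [IsLocalRing T] (ι : k →+* S) :
    Function.Bijective ((residue T).comp ((algebraMap S T).comp ι)) ↔
      ∀ s : S, ∃ c : k, s - ι c ∈ p := by
  have hcomap (s : S) : algebraMap S T s ∈ maximalIdeal T ↔ s ∈ p :=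
    IsLocalization.AtPrime.to_map_mem_maximal_iff T p s
  refine ⟨fun h s ↦ ?_, fun h ↦ ⟨RingHom.injective _, fun t ↦ ?_⟩⟩
  · obtain ⟨c, hc⟩ := h.2 (residue T (algebraMap S T s))
    refine ⟨c, (hcomap _).mp ?_⟩
    rw [map_sub]
    exact Ideal.Quotient.eq.mp hc.symm
  · obtain ⟨t, rfl⟩ := residue_surjective t
    obtain ⟨⟨s, u⟩, hsu⟩ := IsLocalization.surj p.primeCompl t
    obtain ⟨c, hc⟩ := h s
    obtain ⟨c', hc'⟩ := h u
    have hres (s : S) (c : k) (hc : s - ι c ∈ p) :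
        residue T (algebraMap S T s) = residue T (algebraMap S T (ι c)) :=
      Ideal.Quotient.eq.mpr (by rw [← map_sub]; exact (hcomap _).mpr hc)
    have hu : residue T (algebraMap S T u) ≠ 0 := by
      rw [Ne, residue_eq_zero_iff, hcomap]
      exact u.2
    refine ⟨c / c', ?_⟩
    rw [map_div₀]
    simp only [RingHom.comp_apply]
    rw [← hres s c hc, ← hres u c' hc', div_eq_iff hu, ← hsu, map_mul]

/-- A domain has transcendence degree `0` over an algebraically closed field `k` if and only if it
is equal to `k`. -/
theorem iSup_mk_algebraicIndependent_eq_zero_iff_bijective {k K : Type*} [Field k]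
    [IsAlgClosed k] [CommRing K] [IsDomain K] (κ : k →+* K) :
    (⨆ s : {s : Set K // @AlgebraicIndependent s k K ((↑) : s → K) _ _ κ.toAlgebra},
      Cardinal.mk s.1) = 0 ↔ Function.Bijective κ := by
  let := κ.toAlgebra
  change Algebra.trdeg k K = 0 ↔ Function.Bijective (algebraMap k K)
  rw [trdeg_eq_zero_iff]
  refine ⟨fun h ↦ ?_, fun h ↦ ⟨fun t ↦ ?_⟩⟩
  · have := h.isIntegral
    exact IsAlgClosed.algebraMap_bijective_of_isIntegral
  · obtain ⟨c, rfl⟩ := h.2 t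
    exact isAlgebraic_algebraMap c

theorem IsRegLoc.exists_span_range_eq {R : Type*} [CommRing R] [IsLocalRing R] (h : IsRegLoc R)
    {n : ℕ} (hdim : ringKrullDim R = n) :
    ∃ y : Fin n → R, Ideal.span (Set.range y) = maximalIdeal R := by
  obtain ⟨-, -, s, hs, hc⟩ := h
  have hc : s.card = n := by
    rw [hdim] at hc
    exact Nat.cast_injective (R := WithBot ℕ∞) hc
  refine ⟨fun i ↦ s.equivFin.symm (Fin.cast hc.symm i), ?_⟩
  rw [← nuIdeal_eq_maximalIdeal, ← hs]
  congr 1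
  ext r
  constructor
  · rintro ⟨i, rfl⟩
    exact Subtype.coe_prop _
  · intro hr
    exact ⟨Fin.cast hc (s.equivFin ⟨r, hr⟩), by simp⟩

/-- Let `(R, m)` be a local regular domain of dimension `n > 1` containing an
algebraically closed field `k` with `k ≅ R/m`, and let `(T, nT)` be a quadratic transformation
of `R`: `T = S_p` where `S = R[m/x₀]` for some `x₀ ∈ m \ m²`, `p ⊂ S` a prime containing `x₀`,
and `nT = pT`.  Then the following are equivalent:
(1) `dim T = n`;
(2) `tr.deg_{R/m}(T/nT) = 0` (equivalently, `tr.deg_k(T/nT) = 0`, since `k ≅ R/m`);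
(3) the natural homomorphism `k → T/nT` is an isomorphism;
(4) for every regular system of parameters `y₁,...,yₙ` of `R` there exist `j` and constants
`aᵢ ∈ k` (`i ≠ j`) such that `y₁/y_j − a₁, ..., y_j, ..., yₙ/y_j − aₙ` is a regular system of
parameters of `T`. -/
theorem quadratic_transform_tfae
    (k : Type*) [Field k] [IsAlgClosed k]
    (R : Type*) [CommRing R] [IsDomain R] [IsLocalRing R] [Algebra k R]
    (hres : Function.Bijective ((residue R).comp (algebraMap k R)))
    (n : ℕ) (hn : 1 < n) (hreg : IsRegLoc R) (hdim : ringKrullDim R = (n : ℕ))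
    (x0 : R) (hx0 : x0 ∈ maximalIdeal R) (hx02 : x0 ∉ (maximalIdeal R) ^ 2)
    (S : Subalgebra R (FractionRing R))
    (hS : S = Algebra.adjoin R {z : FractionRing R | ∃ a ∈ maximalIdeal R,
      z = algebraMap R (FractionRing R) a / algebraMap R (FractionRing R) x0})
    (p : Ideal S) (hp : p.IsPrime) (hxp : algebraMap R S x0 ∈ p)
    (T : Subalgebra R (FractionRing R)) (hT : T = locSub R S p)
    (nT : Ideal T)
    (hnT : nT = Ideal.span {t : T | ∃ s : S, s ∈ p ∧ (s : FractionRing R) = (t : FractionRing R)}) :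
    List.TFAE
      [ ringKrullDim T = (n : ℕ),
        (⨆ s : {s : Set (T ⧸ nT) //
            @AlgebraicIndependent s k (T ⧸ nT) ((↑) : s → T ⧸ nT) _ _
              ((Ideal.Quotient.mk nT).comp
                ((algebraMap R T).comp (algebraMap k R))).toAlgebra},
          Cardinal.mk s.1) = 0,
        Function.Bijective
          ((Ideal.Quotient.mk nT).comp ((algebraMap R T).comp (algebraMap k R))),
        ∀ y : Fin n → R, Ideal.span (Set.range y) = maximalIdeal R →
          ∃ j : Fin n, ∃ a : Fin n → k,
            ∃ hmem : ∀ i : Fin n,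
              (if i = j then algebraMap R (FractionRing R) (y j)
               else algebraMap R (FractionRing R) (y i) / algebraMap R (FractionRing R) (y j)
                 - algebraMap R (FractionRing R) (algebraMap k R (a i))) ∈ T,
            Ideal.span (Set.range fun i : Fin n =>
              (⟨if i = j then algebraMap R (FractionRing R) (y j)
                else algebraMap R (FractionRing R) (y i) / algebraMap R (FractionRing R) (y j)
                  - algebraMap R (FractionRing R) (algebraMap k R (a i)), hmem i⟩ : T))
              = nuIdeal T ∧
            ringKrullDim T = (n : ℕ) ] := by
  classical
  obtain ⟨d, rfl⟩ : ∃ d, n = d + 1 := ⟨n - 1, by lia⟩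
  have hnoeth : IsNoetherianRing R := hreg.2.1
  have hk (r : R) : ∃ c : k, r - algebraMap k R c ∈ maximalIdeal R := by
    obtain ⟨c, hc⟩ := hres.2 (residue R r)
    exact ⟨c, Ideal.Quotient.eq.mp hc.symm⟩
  have hd : (maximalIdeal R).height = ((d + 1 : ℕ) : ℕ∞) := by
    have h := IsLocalRing.maximalIdeal_height_eq_ringKrullDim (R := R)
    rw [hdim] at h
    exact_mod_cast h
  obtain ⟨y₀, hy₀⟩ := hreg.exists_span_range_eq hdim
  obtain ⟨y', hy'⟩ := exists_span_eq_of_notMem_sq y₀ hy₀ hx0 hx02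
  have hx00 : x0 ≠ 0 := fun h ↦ hx02 (h ▸ zero_mem _)
  have hxF : algebraMap R (FractionRing R) x0 ≠ 0 := by simpa using hx00
  have hlift (r : R) (hr : r ∈ maximalIdeal R) :
      ∃ z : S, algebraMap R S r = algebraMap R S x0 * z :=
    ⟨⟨algebraMap R (FractionRing R) r / algebraMap R (FractionRing R) x0,
      hS ▸ Algebra.subset_adjoin ⟨r, hr, rfl⟩⟩, Subtype.ext (mul_div_cancel₀ _ hxF).symm⟩
  have hinj : Function.Injective (algebraMap R S) := FaithfulSMul.algebraMap_injective R S
  choose z' hz' using fun i ↦ hlift (y' i)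
    (hy' ▸ Ideal.subset_span (Or.inr (Set.mem_range_self i)))
  have hsurj' := aeval_surjective_of_maximalIdeal_le hx00 hS y' hy'.le z' hz'
  have hheight := height_eq_iff_of_chart hinj x0 y' z' hz' hy' hsurj' hd hk p hxp
  subst hT
  set f := Subalgebra.inclusion (le_locSub S p)
  let : Algebra S (locSub R S p) := f.toRingHom.toAlgebra
  have hloc : IsLocalization.AtPrime (locSub R S p) p := isLocalization_locSub S p
  have hlocal : IsLocalRing (locSub R S p) := IsLocalization.AtPrime.isLocalRing _ p
  have hmap : p.map f = maximalIdeal (locSub R S p) :=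
    IsLocalization.AtPrime.map_eq_maximalIdeal p (locSub R S p)
  obtain rfl : nT = maximalIdeal (locSub R S p) := by
    rw [hnT, ← hmap, Ideal.map]
    congr 1
    ext t
    exact exists_congr fun s ↦ and_congr_right fun _ ↦
      (Subtype.ext_iff (a1 := f s) (a2 := t)).symm
  have hdimT : ringKrullDim (locSub R S p) = ((d + 1 : ℕ) : WithBot ℕ∞) ↔
      p.height = ((d + 1 : ℕ) : ℕ∞) := by
    rw [IsLocalization.AtPrime.ringKrullDim_eq_height p]
    exact_mod_cast Iff.rfl
  have hresidue := bijective_residue_iff_forall_exists_sub_mem (T := locSub R S p) p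
    ((algebraMap R S).comp (algebraMap k R))
  tfae_have 1 ↔ 3 := hdimT.trans (hheight.trans hresidue.symm)
  tfae_have 2 ↔ 3 := iSup_mk_algebraicIndependent_eq_zero_iff_bijective _
  tfae_have 4 → 1 := fun h ↦ by
    obtain ⟨-, -, -, -, h⟩ := h y₀ hy₀
    exact h
  tfae_have 3 → 4 := fun h y hy ↦ by
    have hdimT' := hdimT.mpr (hheight.mpr (hresidue.mp h))
    have hym (i) : y i ∈ maximalIdeal R := hy ▸ Ideal.subset_span (Set.mem_range_self i)
    choose z hz using fun i ↦ hlift (y i) (hym i)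
    have hsurj := aeval_surjective_of_maximalIdeal_le hx00 hS y
      (hy.ge.trans (Ideal.span_mono Set.subset_union_right)) z hz
    have hx0S : algebraMap R S x0 ≠ 0 := by simpa using hx00
    obtain ⟨r, hr⟩ := Ideal.mem_span_range_iff_exists_fun.mp (hy.ge hx0)
    have hr : ∑ i, algebraMap R S (r i) * z i = 1 := by
      apply mul_left_cancel₀ hx0S
      rw [mul_one, Finset.mul_sum]
      conv_rhs => rw [← hr, map_sum]
      refine Finset.sum_congr rfl fun i _ ↦ ?_
      rw [map_mul, hz, mul_left_comm]
    obtain ⟨j, hj⟩ : ∃ j, z j ∉ p := by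
      by_contra! h
      exact hp.ne_top ((Ideal.eq_top_iff_one p).mpr
        (hr ▸ sum_mem fun i _ ↦ Ideal.mul_mem_left _ _ (h i)))
    obtain ⟨v, hv⟩ := (IsLocalization.map_units (locSub R S p)
      (⟨z j, hj⟩ : p.primeCompl)).exists_right_inv
    replace hv : f (z j) * v = 1 := hv
    choose a ha using fun i ↦ h.2 (Ideal.Quotient.mk _ (f (z i) * v))
    have ha (i) : f (z i) * v - (algebraMap R (locSub R S p)).comp (algebraMap k R) (a i) ∈
        maximalIdeal (locSub R S p) := Ideal.Quotient.eq.mp (ha i).symm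
    have hxT : algebraMap R (locSub R S p) x0 ∈ maximalIdeal (locSub R S p) :=
      hmap ▸ Ideal.mem_map_of_mem f hxp
    have hspan := span_chart_eq_maximalIdeal f x0 y z hz hy.ge hsurj hk hxT r hr p hmap j v hv a ha
    have hzF (i) : algebraMap R (FractionRing R) (y i) =
        algebraMap R (FractionRing R) x0 * (z i : FractionRing R) := congrArg Subtype.val (hz i)
    have hvF : (z j : FractionRing R) * (v : FractionRing R) = 1 := congrArg Subtype.val hv
    have hzjF : (z j : FractionRing R) ≠ 0 := left_ne_zero_of_mul_eq_one hvF
    have hdiv (i) : algebraMap R (FractionRing R) (y i) / algebraMap R (FractionRing R) (y j) =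
        (z i : FractionRing R) * (v : FractionRing R) := by
      rw [hzF, hzF, mul_div_mul_left _ _ hxF, div_eq_iff hzjF, mul_assoc,
        mul_comm (v : FractionRing R), hvF, mul_one]
    have hval (i) : (if i = j then algebraMap R (FractionRing R) (y j)
        else algebraMap R (FractionRing R) (y i) / algebraMap R (FractionRing R) (y j)
          - algebraMap R (FractionRing R) (algebraMap k R (a i))) =
        ((if i = j then algebraMap R (locSub R S p) (y j) else
          f (z i) * v - (algebraMap R (locSub R S p)).comp (algebraMap k R) (a i) :
            locSub R S p) : FractionRing R) := by
      split_ifs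
      · rfl
      · rw [hdiv]
        rfl
    refine ⟨j, a, fun i ↦ hval i ▸ Subtype.coe_prop _, ?_, hdimT'⟩
    rw [nuIdeal_eq_maximalIdeal, ← hspan]
    congr 2
    funext i
    exact Subtype.ext (hval i)
  tfae_finish

end
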